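/- Let Q and G be labeled graphs, let K be a vertex cover of Q, and let m be an injective function from K to the vertices of G. Suppose there exists a shell vertex s of Q (a vertex of Q outside K) such that no vertex v of G satisfies all three conditions: L(v) = L(s), v is not in the image m(K), and v is adjacent in G to m(u) for every neighbor u of s in Q. Then there is no subgraph isomorphism f from Q to G whose restriction to K equals m. (This is the soundness of pruning a kernel partial match whose shell candidate set is empty.) -/

import Mathlib

/-- A subgraph isomorphism from a labeled query graph `Q` (labels `LQ`) to a labeled
data graph `G` (labels `LG`): an injective, label-preserving map sending edges to edges. -/
def IsSubgraphIso {VQ VG Λ : Type*} (Q : SimpleGraph VQ) (G : SimpleGraph VG)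
    (LQ : VQ → Λ) (LG : VG → Λ) (f : VQ → VG) : Prop :=
  Function.Injective f ∧ (∀ u, LG (f u) = LQ u) ∧
    ∀ ⦃u1 u2⦄, Q.Adj u1 u2 → G.Adj (f u1) (f u2)

/-- soundness of pruning: let `K` be a vertex cover of `Q` and `m` an
injective partial match of `K` into `G`.  If some shell vertex `s ∉ K` admits no
candidate `v` (same label as `s`, outside the image `m '' K`, and adjacent to `m u` for
every neighbor `u` of `s`), then no subgraph isomorphism from `Q` to `G` restricts to
`m` on `K`. -/
theorem prune_kernel_partial_match_of_empty_shell_candidates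
    {VQ VG Λ : Type*} [Fintype VQ] [Fintype VG]
    (Q : SimpleGraph VQ) (G : SimpleGraph VG) (LQ : VQ → Λ) (LG : VG → Λ)
    (K : Set VQ)
    (hCover : ∀ ⦃u1 u2 : VQ⦄, Q.Adj u1 u2 → u1 ∈ K ∨ u2 ∈ K)
    (m : VQ → VG) (hmInj : Set.InjOn m K)
    (s : VQ) (hs : s ∉ K)
    (hEmpty : ¬ ∃ v : VG, LG v = LQ s ∧ v ∉ m '' K ∧
      ∀ ⦃u : VQ⦄, u ∈ Q.neighborSet s → G.Adj v (m u)) :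
    ¬ ∃ f : VQ → VG, IsSubgraphIso Q G LQ LG f ∧ ∀ k ∈ K, f k = m k := by
  rintro ⟨f, ⟨hfInj, hfLabel, hfAdj⟩, hfm⟩
  refine hEmpty ⟨f s, hfLabel s, ?_, fun u hu => ?_⟩
  · rintro ⟨k, hk, hmk⟩
    have hks : k = s := hfInj ((hfm k hk).trans hmk)
    exact hs (hks ▸ hk)
  · rw [← hfm u ((hCover hu).resolve_left hs)]
    exact hfAdj hu
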